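/- There exists a constant $C > 0$ such that for all integers $H \ge 2$, the number of triples $(a_1,a_2,a_3)$ of positive integers with $1 \le a_1,a_2,a_3 \le H$, $\gcd(a_1,a_2) = 1$ and $\gcd(a_1,a_3) = 1$ differs from $H^3 \prod_{p\ \mathrm{prime}}\left(1 - \frac{2p-1}{p^3}\right)$ by at most $C H^2 (\log H)^2$. -/

import Mathlib

open Finset

/-- The function supported on squarefree integers whose value there is the product of `h` over
the prime factors. -/
noncomputable def squarefreeProd (h : ℕ → ℝ) (d : ℕ) : ℝ :=
  if Squarefree d then ∏ p ∈ d.primeFactors, h p else 0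

theorem prod_primeFactors_one_add_eq_sum_squarefreeProd (h : ℕ → ℝ) {n : ℕ} (hn : n ≠ 0) :
    ∏ p ∈ n.primeFactors, (1 + h p) = ∑ d ∈ n.divisors, squarefreeProd h d := by
  unfold squarefreeProd
  rw [← sum_filter, Finset.prod_one_add]
  have hprime : ∀ s ∈ n.primeFactors.powerset, ∀ p ∈ s, p.Prime := fun s hs p hp =>
    Nat.prime_of_mem_primeFactors (mem_powerset.1 hs hp)
  symm
  refine sum_bij' (fun d _ => d.primeFactors) (fun s _ => ∏ p ∈ s, p) ?_ ?_ ?_ ?_ ?_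
  · intro d hd
    simp only [mem_filter, Nat.mem_divisors] at hd
    exact mem_powerset.2 (Nat.primeFactors_mono hd.1.1 hn)
  · intro s hs
    simp only [mem_filter, Nat.mem_divisors]
    refine ⟨⟨?_, hn⟩, ?_⟩
    · exact (prod_dvd_prod_of_subset _ _ _ (mem_powerset.1 hs)).trans
        (Nat.prod_primeFactors_dvd n)
    · refine Finset.squarefree_prod_of_pairwise_isCoprime ?_ ?_
      · intro p hp q hq hpq
        exact Nat.coprime_iff_isRelPrime.1
          ((Nat.coprime_primes (hprime s hs p hp) (hprime s hs q hq)).2 hpq)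
      · exact fun p hp => (hprime s hs p hp).prime.squarefree
  · intro d hd
    exact Nat.prod_primeFactors_of_squarefree (mem_filter.1 hd).2
  · intro s hs
    exact Nat.primeFactors_prod (hprime s hs)
  · intro d _
    rfl

theorem squarefreeProd_one (h : ℕ → ℝ) : squarefreeProd h 1 = 1 := by
  simp [squarefreeProd]

theorem squarefreeProd_prime (h : ℕ → ℝ) {p : ℕ} (hp : p.Prime) : squarefreeProd h p = h p := by
  simp [squarefreeProd, hp.prime.squarefree, hp.primeFactors]

theorem squarefreeProd_prime_pow (h : ℕ → ℝ) {p e : ℕ} (hp : p.Prime) (he : 2 ≤ e) :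
    squarefreeProd h (p ^ e) = 0 := by
  rw [squarefreeProd, if_neg]
  rw [Nat.squarefree_pow_iff hp.ne_one (by lia)]
  lia

theorem squarefreeProd_mul (h : ℕ → ℝ) {m n : ℕ} (hmn : m.Coprime n) :
    squarefreeProd h (m * n) = squarefreeProd h m * squarefreeProd h n := by
  unfold squarefreeProd
  simp only [Nat.squarefree_mul hmn, hmn.primeFactors_mul, prod_union hmn.disjoint_primeFactors]
  by_cases hm : Squarefree m <;> by_cases hn : Squarefree n <;> simp [hm, hn]

theorem abs_squarefreeProd_le {h : ℕ → ℝ} (hh : ∀ p, p.Prime → |h p| ≤ 2 / p) (d : ℕ) :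
    |squarefreeProd h d| ≤ #d.divisors * (d : ℝ)⁻¹ := by
  unfold squarefreeProd
  split_ifs with hd
  · have hcard : ∏ p ∈ d.primeFactors, (2 : ℝ) ≤ #d.divisors := by
      have := prod_primeFactors_one_add_eq_sum_squarefreeProd (fun _ => 1) hd.ne_zero
      norm_num at this
      rw [prod_const, this, card_eq_sum_ones]
      push_cast
      refine sum_le_sum fun e _ => ?_
      unfold squarefreeProd
      split_ifs <;> simp
    calc |∏ p ∈ d.primeFactors, h p| = ∏ p ∈ d.primeFactors, |h p| := abs_prod _ _
      _ ≤ ∏ p ∈ d.primeFactors, (2 / p : ℝ) :=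
        prod_le_prod (fun _ _ => abs_nonneg _)
          fun p hp => hh p (Nat.prime_of_mem_primeFactors hp)
      _ = (∏ p ∈ d.primeFactors, (2 : ℝ)) * (d : ℝ)⁻¹ := by
        rw [prod_div_distrib, ← Nat.cast_prod, Nat.prod_primeFactors_of_squarefree hd,
          div_eq_mul_inv]
      _ ≤ _ := by gcongr
  · simp only [abs_zero]
    positivity

theorem sum_Ioc_sum_divisors (f : ℕ → ℝ) (N : ℕ) :
    ∑ n ∈ Ioc 0 N, ∑ d ∈ n.divisors, f d = ∑ d ∈ Ioc 0 N, f d * (N / d : ℕ) := by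
  have hdiv : ∀ n ∈ Ioc 0 N, ∑ d ∈ n.divisors, f d = ∑ d ∈ Ioc 0 N, if d ∣ n then f d else 0 := by
    intro n hn
    rw [← sum_filter]
    refine sum_congr ?_ fun _ _ => rfl
    ext d
    simp only [mem_Ioc] at hn
    simp only [Nat.mem_divisors, mem_filter, mem_Ioc]
    exact ⟨fun hd => ⟨⟨Nat.pos_of_dvd_of_pos hd.1 hn.1, (Nat.le_of_dvd hn.1 hd.1).trans hn.2⟩,
      hd.1⟩, fun hd => ⟨hd.2, hn.1.ne'⟩⟩
  rw [sum_congr rfl hdiv, sum_comm]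
  refine sum_congr rfl fun d _ => ?_
  rw [← sum_filter, sum_const, Nat.Ioc_filter_dvd_card_eq_div, nsmul_eq_mul, mul_comm]

theorem sum_Ioc_card_divisors_mul (f : ℕ → ℝ) (A N : ℕ) :
    ∑ n ∈ Ioc A N, #n.divisors * f n =
      ∑ u ∈ Ioc 0 N, ∑ v ∈ Ioc 0 N with u * v ∈ Ioc A N, f (u * v) := by
  simp_rw [sum_filter]
  rw [← sum_product' (Ioc 0 N) (Ioc 0 N) fun u v => if u * v ∈ Ioc A N then f (u * v) else 0,
    ← sum_filter,
    ← sum_fiberwise_of_maps_to (t := Ioc A N) (g := fun x : ℕ × ℕ => x.1 * x.2)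
      (fun x hx => (mem_filter.1 hx).2)]
  refine sum_congr rfl fun n hn => ?_
  have hn' := mem_Ioc.1 hn
  rw [sum_congr rfl (g := fun _ => f n) (by
      intro x hx
      rw [(mem_filter.1 hx).2]), sum_const, nsmul_eq_mul]
  have hanti : {x ∈ (Ioc 0 N ×ˢ Ioc 0 N).filter fun x => x.1 * x.2 ∈ Ioc A N | x.1 * x.2 = n} =
      n.divisorsAntidiagonal := by
    rw [Nat.divisorsAntidiagonal_eq_prod_filter_of_le (by lia) hn'.2, filter_filter]
    exact filter_congr fun x _ => and_iff_right_of_imp fun hx => hx ▸ hn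
  rw [hanti, ← Nat.map_div_right_divisors, card_map]

theorem sum_Ioc_inv_le (N : ℕ) : ∑ n ∈ Ioc 0 N, (n : ℝ)⁻¹ ≤ 1 + Real.log N := by
  have := harmonic_le_one_add_log N
  rw [harmonic_eq_sum_Icc] at this
  push_cast at this
  exact this

theorem sum_Ioc_card_divisors_mul_inv_le (N : ℕ) :
    ∑ n ∈ Ioc 0 N, #n.divisors * (n : ℝ)⁻¹ ≤ (1 + Real.log N) ^ 2 := by
  have hpos : 0 ≤ ∑ n ∈ Ioc 0 N, (n : ℝ)⁻¹ := by positivity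
  rw [sum_Ioc_card_divisors_mul (fun n => (n : ℝ)⁻¹)]
  calc _ ≤ ∑ u ∈ Ioc 0 N, ∑ v ∈ Ioc 0 N, (u : ℝ)⁻¹ * (v : ℝ)⁻¹ := by
        refine sum_le_sum fun u _ => ?_
        simp only [Nat.cast_mul, mul_inv]
        exact sum_le_sum_of_subset_of_nonneg (filter_subset _ _) fun _ _ _ => by positivity
    _ = (∑ n ∈ Ioc 0 N, (n : ℝ)⁻¹) ^ 2 := by rw [sq, sum_mul_sum]
    _ ≤ _ := pow_le_pow_left₀ hpos (sum_Ioc_inv_le N) 2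

theorem sum_Ioc_card_divisors_mul_inv_sq_le {A : ℕ} (hA : 0 < A) (N : ℕ) :
    ∑ n ∈ Ioc A N, #n.divisors * ((n : ℝ) ^ 2)⁻¹ ≤ (2 * Real.log A + 6) / A := by
  have hA' : (0 : ℝ) < A := by exact_mod_cast hA
  rw [sum_Ioc_card_divisors_mul (fun n => ((n : ℝ) ^ 2)⁻¹)]
  have hinner : ∀ u ∈ Ioc 0 N, ∑ v ∈ Ioc 0 N with u * v ∈ Ioc A N, (((u * v : ℕ) : ℝ) ^ 2)⁻¹ ≤
      (if u ∈ Ioc 0 A then 2 / A * (u : ℝ)⁻¹ else 0) +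
        if u ∈ Ioo A (N + 1) then 2 * ((u : ℝ) ^ 2)⁻¹ else 0 := by
    intro u hu
    have hu0 : 0 < u := (mem_Ioc.1 hu).1
    have hu' : (0 : ℝ) < u := by exact_mod_cast hu0
    have hsub : ∑ v ∈ Ioc 0 N with u * v ∈ Ioc A N, (((u * v : ℕ) : ℝ) ^ 2)⁻¹ ≤
        ((u : ℝ) ^ 2)⁻¹ * (2 / ((A / u : ℕ) + 1)) := by
      calc _ ≤ ∑ v ∈ Ioo (A / u) (N + 1), (((u * v : ℕ) : ℝ) ^ 2)⁻¹ := by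
            refine sum_le_sum_of_subset_of_nonneg ?_ fun _ _ _ => by positivity
            intro v hv
            simp only [mem_filter, mem_Ioc, mem_Ioo] at hv ⊢
            exact ⟨Nat.div_lt_of_lt_mul hv.2.1, by lia⟩
        _ = ((u : ℝ) ^ 2)⁻¹ * ∑ v ∈ Ioo (A / u) (N + 1), ((v : ℝ) ^ 2)⁻¹ := by
            simp only [mul_sum, Nat.cast_mul, mul_pow, mul_inv]
        _ ≤ _ := by gcongr; exact sum_Ioo_inv_sq_le _ _
    refine hsub.trans ?_
    rcases le_or_gt u A with huA | huA
    · rw [if_pos (mem_Ioc.2 ⟨hu0, huA⟩), if_neg (by simp; lia), add_zero]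
      have hlt : (A : ℝ) / u ≤ (A / u : ℕ) + 1 := by
        rw [div_le_iff₀ hu']
        have := Nat.lt_div_mul_add (a := A) hu0
        have : A ≤ (A / u + 1) * u := by linarith [add_mul (A / u) 1 u]
        exact_mod_cast this
      calc ((u : ℝ) ^ 2)⁻¹ * (2 / ((A / u : ℕ) + 1)) ≤ ((u : ℝ) ^ 2)⁻¹ * (2 / (A / u)) := by
            gcongr
        _ = _ := by field_simp
    · rw [if_neg (by simp; lia), if_pos (by simp at hu ⊢; lia), zero_add,
        Nat.div_eq_of_lt huA]
      simp [mul_comm]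
  refine (sum_le_sum hinner).trans ?_
  rw [sum_add_distrib, ← sum_filter, ← sum_filter]
  have hsmall : ∑ u ∈ Ioc 0 N with u ∈ Ioc 0 A, 2 / A * (u : ℝ)⁻¹ ≤
      2 / A * (1 + Real.log A) := by
    rw [← mul_sum]
    gcongr
    refine le_trans ?_ (sum_Ioc_inv_le A)
    exact sum_le_sum_of_subset_of_nonneg (fun u hu => (mem_filter.1 hu).2)
      fun _ _ _ => by positivity
  have hlarge : ∑ u ∈ Ioc 0 N with u ∈ Ioo A (N + 1), 2 * ((u : ℝ) ^ 2)⁻¹ ≤ 2 * (2 / A) := by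
    rw [← mul_sum]
    gcongr
    calc _ ≤ ∑ u ∈ Ioo A (N + 1), ((u : ℝ) ^ 2)⁻¹ :=
          sum_le_sum_of_subset_of_nonneg (fun u hu => (mem_filter.1 hu).2)
            fun _ _ _ => by positivity
      _ ≤ 2 / (A + 1) := sum_Ioo_inv_sq_le _ _
      _ ≤ 2 / A := by gcongr; linarith
  calc _ ≤ _ := add_le_add hsmall hlarge
    _ = _ := by ring

theorem card_coprime_eq_sum_moebius {a : ℕ} (ha : a ≠ 0) (H : ℕ) :
    (#{b ∈ Ioc 0 H | a.gcd b = 1} : ℝ) =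
      ∑ d ∈ a.divisors, (ArithmeticFunction.moebius d : ℝ) * (H / d : ℕ) := by
  have hind : ∀ b ∈ Ioc 0 H, (if a.gcd b = 1 then (1 : ℝ) else 0) =
      ∑ d ∈ a.divisors, if d ∣ b then (ArithmeticFunction.moebius d : ℝ) else 0 := by
    intro b _
    rw [← sum_filter]
    have := congrArg (fun f => f (a.gcd b))
      (ArithmeticFunction.coe_moebius_mul_coe_zeta (R := ℝ))
    simp only [ArithmeticFunction.coe_mul_zeta_apply, ArithmeticFunction.one_apply,
      ArithmeticFunction.intCoe_apply] at this
    rw [← this]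
    refine sum_congr ?_ fun _ _ => rfl
    ext d
    simp [Nat.dvd_gcd_iff, ha]
  rw [card_filter]
  push_cast
  rw [sum_congr rfl hind, sum_comm]
  refine sum_congr rfl fun d _ => ?_
  rw [← sum_filter, sum_const, Nat.Ioc_filter_dvd_card_eq_div, nsmul_eq_mul, mul_comm]

theorem totient_eq_sum_moebius {a : ℕ} (ha : a ≠ 0) :
    (a.totient : ℝ) =
      ∑ d ∈ a.divisors, (ArithmeticFunction.moebius d : ℝ) * (a / d : ℕ) := by
  rw [← card_coprime_eq_sum_moebius ha, ← Nat.filter_coprime_Ico_eq_totient a 1]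
  congr 2
  ext b
  simp only [mem_filter, mem_Ico, mem_Ioc, Nat.Coprime]
  lia

theorem abs_natCast_div_sub_le (H : ℕ) {d : ℕ} (hd : d ≠ 0) :
    |((H / d : ℕ) : ℝ) - H / d| ≤ 1 := by
  have hd' : (0 : ℝ) < d := by exact_mod_cast Nat.pos_of_ne_zero hd
  have hle : ((H / d : ℕ) : ℝ) ≤ H / d := Nat.cast_div_le
  have hlt : (H : ℝ) / d < (H / d : ℕ) + 1 := by
    rw [← Nat.floor_div_eq_div (K := ℝ)]
    exact Nat.lt_floor_add_one _
  rw [abs_le]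
  constructor <;> linarith

theorem abs_card_coprime_sub_le {a : ℕ} (ha : a ≠ 0) (H : ℕ) :
    |(#{b ∈ Ioc 0 H | a.gcd b = 1} : ℝ) - H * (a.totient / a)| ≤ #a.divisors := by
  have ha' : (a : ℝ) ≠ 0 := by exact_mod_cast ha
  rw [card_coprime_eq_sum_moebius ha, totient_eq_sum_moebius ha, sum_div, mul_sum,
    ← sum_sub_distrib, card_eq_sum_ones]
  push_cast
  refine (abs_sum_le_sum_abs _ _).trans (sum_le_sum fun d hd => ?_)
  have hd0 : d ≠ 0 := (Nat.pos_of_mem_divisors hd).ne'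
  have hd0' : (d : ℝ) ≠ 0 := by exact_mod_cast hd0
  have hmu : |(ArithmeticFunction.moebius d : ℝ)| ≤ 1 := by
    exact_mod_cast ArithmeticFunction.abs_moebius_le_one (n := d)
  rw [Nat.cast_div (Nat.dvd_of_mem_divisors hd) hd0']
  calc _ = |(ArithmeticFunction.moebius d : ℝ)| * |((H / d : ℕ) : ℝ) - H / d| := by
        rw [← abs_mul]
        congr 1
        field_simp
    _ ≤ 1 * 1 := by
        gcongr
        exact abs_natCast_div_sub_le H hd0
    _ = 1 := one_mul 1

theorem sum_Ioc_card_divisors_le (N : ℕ) :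
    ∑ n ∈ Ioc 0 N, (#n.divisors : ℝ) ≤ N * (1 + Real.log N) := by
  have h := sum_Ioc_sum_divisors (fun _ => 1) N
  simp only [sum_const, nsmul_eq_mul, mul_one, one_mul] at h
  rw [h]
  calc _ ≤ ∑ d ∈ Ioc 0 N, (N : ℝ) * (d : ℝ)⁻¹ :=
        sum_le_sum fun d _ => Nat.cast_div_le.trans_eq (div_eq_mul_inv _ _)
    _ ≤ _ := by
        rw [← mul_sum]
        gcongr
        exact sum_Ioc_inv_le N

/-- The value at a prime `p` of the Möbius transform of `n ↦ (φ n / n) ^ 2`. -/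
noncomputable def totientSqWeight (p : ℕ) : ℝ := -(2 * p - 1) / (p : ℝ) ^ 2

theorem abs_totientSqWeight_le {p : ℕ} (hp : p.Prime) : |totientSqWeight p| ≤ 2 / p := by
  have h1 : (1 : ℝ) ≤ p := by exact_mod_cast hp.one_le
  have h0 : (0 : ℝ) < p := by linarith
  rw [totientSqWeight, abs_div, abs_neg, abs_of_nonneg (by linarith : (0 : ℝ) ≤ 2 * p - 1),
    abs_of_nonneg (by positivity), div_le_div_iff₀ (by positivity) h0]
  nlinarith

theorem totient_div_sq_eq_sum {a : ℕ} (ha : a ≠ 0) :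
    ((a.totient : ℝ) / a) ^ 2 = ∑ d ∈ a.divisors, squarefreeProd totientSqWeight d := by
  have ha' : (a : ℝ) ≠ 0 := by exact_mod_cast ha
  have htot : (a.totient : ℝ) = a * ∏ p ∈ a.primeFactors, (1 - (p : ℝ)⁻¹) := by
    have h := congrArg (Rat.cast : ℚ → ℝ) (Nat.totient_eq_mul_prod_factors a)
    push_cast at h
    exact h
  rw [← prod_primeFactors_one_add_eq_sum_squarefreeProd _ ha, htot,
    mul_div_cancel_left₀ _ ha', ← prod_pow]
  refine prod_congr rfl fun p hp => ?_
  have hp0 : (p : ℝ) ≠ 0 := by exact_mod_cast (Nat.prime_of_mem_primeFactors hp).ne_zero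
  rw [totientSqWeight]
  field_simp
  ring

theorem norm_squarefreeProd_totientSqWeight_div_le (d : ℕ) :
    ‖squarefreeProd totientSqWeight d / d‖ ≤ #d.divisors * ((d : ℝ) ^ 2)⁻¹ := by
  rw [Real.norm_eq_abs, abs_div, Nat.abs_cast, div_eq_mul_inv]
  calc _ ≤ #d.divisors * (d : ℝ)⁻¹ * (d : ℝ)⁻¹ := by
        gcongr
        exact abs_squarefreeProd_le (fun p hp => abs_totientSqWeight_le hp) d
    _ = _ := by rw [sq, mul_inv, mul_assoc]

theorem summable_norm_squarefreeProd_totientSqWeight_div :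
    Summable fun d : ℕ => ‖squarefreeProd totientSqWeight d / d‖ := by
  rw [← summable_nat_add_iff 2]
  refine summable_of_sum_range_le (c := (2 * Real.log (1 : ℕ) + 6) / (1 : ℕ))
    (fun _ => norm_nonneg _) fun n => ?_
  refine le_trans ?_ (sum_Ioc_card_divisors_mul_inv_sq_le one_pos (n + 1))
  refine (sum_le_sum fun d _ => norm_squarefreeProd_totientSqWeight_div_le (d + 2)).trans ?_
  rw [← Finset.Ico_add_one_add_one_eq_Ioc, sum_Ico_eq_sum_range,
    show n + 1 + 1 - (1 + 1) = n by lia]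
  simp [add_comm]

theorem tprod_primes_eq_tsum :
    ∏' p : Nat.Primes, (1 - (2 * (p : ℕ) - 1) / ((p : ℕ) : ℝ) ^ 3) =
      ∑' d : ℕ, squarefreeProd totientSqWeight d / d := by
  rw [← EulerProduct.eulerProduct_tprod (f := fun d : ℕ => squarefreeProd totientSqWeight d / d)
    (by simp [squarefreeProd_one]) (fun {m n} hmn => by
      rw [squarefreeProd_mul _ hmn, Nat.cast_mul, mul_div_mul_comm])
    summable_norm_squarefreeProd_totientSqWeight_div (by simp)]
  refine tprod_congr fun p => ?_
  have hp0 : ((p : ℕ) : ℝ) ≠ 0 := by exact_mod_cast p.2.ne_zero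
  rw [tsum_eq_sum (s := range 2) fun e he => by
    rw [squarefreeProd_prime_pow _ p.2 (by simp at he; lia), zero_div]]
  rw [sum_range_succ, sum_range_one, pow_zero, pow_one, squarefreeProd_one,
    squarefreeProd_prime _ p.2, totientSqWeight]
  push_cast
  field_simp
  ring

theorem abs_sum_Ioc_sub_tsum_le {H : ℕ} (hH : 0 < H) :
    |∑ d ∈ Ioc 0 H, squarefreeProd totientSqWeight d / d -
      ∑' d : ℕ, squarefreeProd totientSqWeight d / d| ≤ (2 * Real.log H + 6) / H := by
  have hsum := summable_norm_squarefreeProd_totientSqWeight_div.of_norm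
  have hrange : ∀ N, ∑ d ∈ Ioc 0 N, squarefreeProd totientSqWeight d / d =
      ∑ d ∈ range (N + 1), squarefreeProd totientSqWeight d / d := by
    intro N
    rw [sum_range_succ', ← Finset.Ico_add_one_add_one_eq_Ioc, sum_Ico_eq_sum_range]
    simp [add_comm]
  have htend : Filter.Tendsto (fun N => ∑ d ∈ Ioc 0 N, squarefreeProd totientSqWeight d / d)
      Filter.atTop (nhds (∑' d : ℕ, squarefreeProd totientSqWeight d / d)) := by
    simp_rw [hrange]
    exact hsum.hasSum.tendsto_sum_nat.comp (Filter.tendsto_add_atTop_nat 1)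
  refine le_of_tendsto (tendsto_const_nhds.sub htend).abs ?_
  filter_upwards [Filter.eventually_ge_atTop H] with N hN
  rw [abs_sub_comm, ← sum_Ioc_consecutive _ (Nat.zero_le H) hN, add_sub_cancel_left]
  refine (abs_sum_le_sum_abs _ _).trans ?_
  exact (sum_le_sum fun d _ => norm_squarefreeProd_totientSqWeight_div_le d).trans
    (sum_Ioc_card_divisors_mul_inv_sq_le hH N)

theorem abs_sum_totient_div_sq_sub_le {H : ℕ} (hH : 0 < H) :
    |∑ a ∈ Ioc 0 H, ((a.totient : ℝ) / a) ^ 2 -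
      H * ∑' d : ℕ, squarefreeProd totientSqWeight d / d| ≤
      (1 + Real.log H) ^ 2 + (2 * Real.log H + 6) := by
  have hH' : (0 : ℝ) < H := by exact_mod_cast hH
  have hconv : ∑ a ∈ Ioc 0 H, ((a.totient : ℝ) / a) ^ 2 =
      ∑ d ∈ Ioc 0 H, squarefreeProd totientSqWeight d * (H / d : ℕ) := by
    rw [← sum_Ioc_sum_divisors]
    exact sum_congr rfl fun a ha => totient_div_sq_eq_sum (mem_Ioc.1 ha).1.ne'
  have hfloor : |∑ d ∈ Ioc 0 H, squarefreeProd totientSqWeight d * (H / d : ℕ) -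
      H * ∑ d ∈ Ioc 0 H, squarefreeProd totientSqWeight d / d| ≤ (1 + Real.log H) ^ 2 := by
    rw [mul_sum, ← sum_sub_distrib]
    refine (abs_sum_le_sum_abs _ _).trans
      ((sum_le_sum fun d hd => ?_).trans (sum_Ioc_card_divisors_mul_inv_le H))
    calc _ = |squarefreeProd totientSqWeight d| * |((H / d : ℕ) : ℝ) - H / d| := by
          rw [← abs_mul]
          congr 1
          ring
      _ ≤ |squarefreeProd totientSqWeight d| * 1 := by
          gcongr
          exact abs_natCast_div_sub_le H (mem_Ioc.1 hd).1.ne'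
      _ ≤ _ := by
          rw [mul_one]
          exact abs_squarefreeProd_le (fun p hp => abs_totientSqWeight_le hp) d
  have htail : |H * ∑ d ∈ Ioc 0 H, squarefreeProd totientSqWeight d / d -
      H * ∑' d : ℕ, squarefreeProd totientSqWeight d / d| ≤ 2 * Real.log H + 6 := by
    rw [← mul_sub, abs_mul, Nat.abs_cast, ← le_div_iff₀' hH']
    exact abs_sum_Ioc_sub_tsum_le hH
  rw [hconv]
  exact (abs_sub_le _ _ _).trans (add_le_add hfloor htail)

theorem abs_sum_card_coprime_sq_sub_le (H : ℕ) :
    |∑ a ∈ Ioc 0 H, (#{b ∈ Ioc 0 H | a.gcd b = 1} : ℝ) ^ 2 -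
      (H : ℝ) ^ 2 * ∑ a ∈ Ioc 0 H, ((a.totient : ℝ) / a) ^ 2| ≤
      2 * (H : ℝ) ^ 2 * (1 + Real.log H) := by
  rw [mul_sum, ← sum_sub_distrib]
  calc _ ≤ ∑ a ∈ Ioc 0 H, #a.divisors * (2 * (H : ℝ)) := by
        refine (abs_sum_le_sum_abs _ _).trans (sum_le_sum fun a ha => ?_)
        have ha0 : a ≠ 0 := (mem_Ioc.1 ha).1.ne'
        have hcard : (#{b ∈ Ioc 0 H | a.gcd b = 1} : ℝ) ≤ H := by
          exact_mod_cast (card_filter_le _ _).trans_eq (by simp)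
        have htot : (a.totient : ℝ) / a ≤ 1 :=
          div_le_one_of_le₀ (by exact_mod_cast a.totient_le) (by positivity)
        have hmain : H * ((a.totient : ℝ) / a) ≤ H := mul_le_of_le_one_right (by positivity) htot
        rw [← mul_pow, sq_sub_sq, mul_comm, abs_mul]
        gcongr
        · exact abs_card_coprime_sub_le ha0 H
        · rw [abs_of_nonneg (by positivity)]
          linarith
    _ ≤ H * (1 + Real.log H) * (2 * H) := by
        rw [← sum_mul]
        gcongr
        exact sum_Ioc_card_divisors_le H
    _ = _ := by ring

theorem card_triples_eq_sum_card_coprime_sq (s : Finset ℕ) :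
    #{a ∈ s ×ˢ s ×ˢ s | Nat.gcd a.1 a.2.1 = 1 ∧ Nat.gcd a.1 a.2.2 = 1} =
      ∑ a ∈ s, #{b ∈ s | a.gcd b = 1} ^ 2 := by
  rw [card_filter, sum_product]
  refine sum_congr rfl fun a _ => ?_
  rw [← card_filter, sq, ← card_product, ← filter_product]

theorem count_two_coprimality_conditions_asymptotic :
    ∃ C : ℝ, 0 < C ∧ ∀ H : ℕ, 2 ≤ H →
      |((((Finset.Icc 1 H ×ˢ Finset.Icc 1 H ×ˢ Finset.Icc 1 H).filter
          (fun a => Nat.gcd a.1 a.2.1 = 1 ∧ Nat.gcd a.1 a.2.2 = 1)).card : ℝ) -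
        (H : ℝ) ^ 3 * ∏' p : Nat.Primes, (1 - (2 * (p : ℕ) - 1) / ((p : ℕ) : ℝ) ^ 3))|
      ≤ C * (H : ℝ) ^ 2 * (Real.log H) ^ 2 := by
  refine ⟨49, by norm_num, fun H hH => ?_⟩
  have hIcc : Icc 1 H = Ioc 0 H := rfl
  rw [tprod_primes_eq_tsum, card_triples_eq_sum_card_coprime_sq, hIcc]
  push_cast
  have hlog : 1 / 2 ≤ Real.log H := by
    have h2 : Real.log 2 ≤ Real.log H :=
      Real.log_le_log (by norm_num) (by exact_mod_cast hH)
    linarith [Real.log_two_gt_d9]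
  have hcount := abs_sum_card_coprime_sq_sub_le H
  have htotient : |(H : ℝ) ^ 2 * ∑ a ∈ Ioc 0 H, ((a.totient : ℝ) / a) ^ 2 -
      (H : ℝ) ^ 3 * ∑' d : ℕ, squarefreeProd totientSqWeight d / d| ≤
      (H : ℝ) ^ 2 * ((1 + Real.log H) ^ 2 + (2 * Real.log H + 6)) := by
    rw [pow_succ (H : ℝ) 2, mul_assoc, ← mul_sub, abs_mul, abs_of_nonneg (by positivity)]
    gcongr
    exact abs_sum_totient_div_sq_sub_le (by lia)
  calc _ ≤ _ := (abs_sub_le _ _ _).trans (add_le_add hcount htotient)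
    _ = (H : ℝ) ^ 2 * (2 * (1 + Real.log H) + ((1 + Real.log H) ^ 2 + (2 * Real.log H + 6))) := by
        ring
    _ ≤ (H : ℝ) ^ 2 * (49 * Real.log H ^ 2) := by
        gcongr
        nlinarith
    _ = _ := by ring
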